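/- arXiv:2102.13041 — 2 statements merged into one kernel-verified Lean document; each statement's English description precedes it below -/
import Mathlib

section
/- (Γ-liminf inequality) Let d ≥ 2, s ≥ 1, and let {r_n} ⊂ (0,+∞) with r_n → 0⁺. Let E ⊆ ℝ^d be measurable with finite Lebesgue measure. Then for every sequence {E_n} of measurable sets of finite Lebesgue measure with χ_{E_n} → χ_E strongly in L¹(ℝ^d), one has ω_{d−1}·Per(E) ≤ liminf_{n→∞} J̃_{r_n}^s(E_n)/σ^s(r_n) (as an inequality in [0,+∞]). -/
open MeasureTheory Filter Set Metric
open scoped ENNReal NNReal symmDiff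

noncomputable section

abbrev Euc (d : ℕ) : Type := EuclideanSpace ℝ (Fin d)

/-- The kernel `k^s_r`. -/
def ker (d : ℕ) (s r t : ℝ) : ℝ :=
  if t ≤ r then r ^ (-((d : ℝ) + s)) else t ^ (-((d : ℝ) + s))

/-- The regularized `s`-fractional perimeter `J̃_r^s(E) = ∫_E ∫_{Eᶜ} k^s_r(|x-y|) dy dx`. -/
def Jt (d : ℕ) (s r : ℝ) (E : Set (Euc d)) : ℝ≥0∞ :=
  ∫⁻ x in E, ∫⁻ y in Eᶜ, ENNReal.ofReal (ker d s r (dist x y))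

/-- The scaling factor `σ^s(r)`. -/
def sgm (d : ℕ) (s r : ℝ) : ℝ :=
  if s = 1 then |Real.log r| else (((d : ℝ) + s) / ((d : ℝ) + 1)) * r ^ (1 - s) / (s - 1)

/-- The scaling factor `β(r,s)` for the simultaneous limit. -/
def betaScale (d : ℕ) (s r : ℝ) : ℝ :=
  (((d : ℝ) + s) / ((d : ℝ) + 1)) * ((r ^ (1 - s) - 1) / (s - 1)) + 1 / ((d : ℝ) + 1)

/-- `ω_k`: Lebesgue measure of the unit ball in `ℝ^k`. -/
def omegaB (k : ℕ) : ℝ := (volume (ball (0 : Euc k) 1)).toReal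

/-- Divergence of a vector field on `ℝ^d`. -/
def diverg {d : ℕ} (Φ : Euc d → Euc d) (x : Euc d) : ℝ :=
  ∑ i : Fin d, fderiv ℝ Φ x (EuclideanSpace.single i 1) i

/-- De Giorgi perimeter. -/
def Per (d : ℕ) (E : Set (Euc d)) : ℝ≥0∞ :=
  ⨆ (Φ : Euc d → Euc d) (_ : ContDiff ℝ 1 Φ) (_ : HasCompactSupport Φ)
    (_ : ∀ x, ‖Φ x‖ ≤ 1), ENNReal.ofReal (∫ x in E, diverg Φ x)

/-- The cube `lQ + ξ` where `Q = [-1/2, 1/2)^d`. -/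
def cube (d : ℕ) (l : ℝ) (ξ : Euc d) : Set (Euc d) :=
  {x | ∀ i, x i ∈ Set.Ico (ξ i - l / 2) (ξ i + l / 2)}

/-- Half space `H⁻_ν(0)`. -/
def Hminus (d : ℕ) (ν : Euc d) : Set (Euc d) := {y | @inner ℝ _ _ ν y ≤ 0}

/-- Standard (normalized) `k`-dimensional Hausdorff measure on `ℝ^d`:
Mathlib's `μH[k]` uses `diam^k` gauges without the normalizing constant `ω_k/2^k`. -/
def Hstd (d : ℕ) (k : ℕ) : Measure (Euc d) :=
  (ENNReal.ofReal (omegaB k / 2 ^ k)) • (μH[(k : ℝ)] : Measure (Euc d))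

/-- The nonlocal `k^s_r`-curvature. -/
def curv (d : ℕ) (s r : ℝ) (E : Set (Euc d)) (x : Euc d) : ℝ :=
  ∫ y, (Set.indicator Eᶜ (fun _ => (1 : ℝ)) y - Set.indicator E (fun _ => (1 : ℝ)) y)
    * ker d s r (dist x y)

/-- The class `𝔈`: closures of open sets with compact `C²` boundary. -/
def IsC2Domain (d : ℕ) (E : Set (Euc d)) : Prop :=
  ∃ U : Set (Euc d), IsOpen U ∧ E = closure U ∧ IsCompact (frontier U) ∧
    ∃ f : Euc d → ℝ, ContDiff ℝ 2 f ∧ U = {x | f x < 0} ∧ frontier U = {x | f x = 0} ∧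
      ∀ x ∈ frontier U, fderiv ℝ f x ≠ 0

lemma polar_hom {d : ℕ} (hd : 1 ≤ d) (f : ℝ → ℝ≥0∞) (hf : Measurable f) (q : Euc d → ℝ≥0∞)
    (hq : Measurable q) (hhom : ∀ (t : ℝ) (x : Euc d), 0 < t → q (t • x) = ENNReal.ofReal t * q x) :
    ∫⁻ h : Euc d, f ‖h‖ * q h =
      (∫⁻ θ : sphere (0 : Euc d) 1, q θ ∂((volume : Measure (Euc d)).toSphere)) *
        ∫⁻ t in Ioi (0 : ℝ), f t * ENNReal.ofReal (t ^ d) := by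
  have : Nonempty (Fin d) := ⟨⟨0, hd⟩⟩
  have hfr : Module.finrank ℝ (Euc d) = d := by simp
  calc ∫⁻ h : Euc d, f ‖h‖ * q h
      = ∫⁻ h in ({0}ᶜ : Set (Euc d)), f ‖h‖ * q h := by rw [restrict_compl_singleton]
    _ = ∫⁻ x : ({(0)}ᶜ : Set (Euc d)), f ‖x.1‖ * q x.1 ∂((volume : Measure (Euc d)).comap (↑)) :=
        (lintegral_subtype_comap (measurableSet_singleton _).compl (fun h => f ‖h‖ * q h)).symm
    _ = ∫⁻ p, f p.2.1 * (ENNReal.ofReal p.2.1 * q p.1.1)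
          ∂((volume : Measure (Euc d)).toSphere.prod (.volumeIoiPow (Module.finrank ℝ (Euc d) - 1))) := by
        rw [← (volume : Measure (Euc d)).measurePreserving_homeomorphUnitSphereProd.lintegral_comp_emb
          (Homeomorph.measurableEmbedding _)]
        refine lintegral_congr fun x => ?_
        have hx : 0 < ‖x.1‖ := norm_pos_iff.2 x.2
        simp only [homeomorphUnitSphereProd_apply_snd_coe, homeomorphUnitSphereProd_apply_fst_coe]
        rw [← hhom _ _ hx, smul_smul, mul_inv_cancel₀ hx.ne', one_smul]
    _ = ∫⁻ p, q p.1.1 * (f p.2.1 * ENNReal.ofReal p.2.1)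
          ∂((volume : Measure (Euc d)).toSphere.prod (.volumeIoiPow (Module.finrank ℝ (Euc d) - 1))) := by
        refine lintegral_congr fun x => ?_
        ring
    _ = _ := by
        rw [lintegral_prod_mul (f := fun θ : sphere (0 : Euc d) 1 => q θ)
          (g := fun t : Ioi (0:ℝ) => f t * ENNReal.ofReal t) (by fun_prop) (by fun_prop)]
        congr 1
        rw [Measure.volumeIoiPow, lintegral_withDensity_eq_lintegral_mul _ (by fun_prop) (by fun_prop)]
        rw [← lintegral_subtype_comap measurableSet_Ioi]
        refine lintegral_congr fun t => ?_
        have ht : (0:ℝ) ≤ t.1 := le_of_lt t.2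
        simp only [Pi.mul_apply]
        rw [mul_left_comm, ← ENNReal.ofReal_mul (by positivity), ← pow_succ, hfr,
          Nat.sub_add_cancel hd]

lemma gauss_lint (d : ℕ) : ∫⁻ t in Ioi (0 : ℝ), ENNReal.ofReal (Real.exp (-t^2)) * ENNReal.ofReal (t ^ d)
    = ENNReal.ofReal (Real.Gamma (((d:ℝ)+1)/2) / 2) := by
  have h := integral_rpow_mul_exp_neg_rpow (p := 2) (q := d) (by norm_num) (by
    have : (0:ℝ) ≤ d := by positivity
    linarith)
  have hpos : 0 < Real.Gamma (((d:ℝ)+1)/2) := Real.Gamma_pos_of_pos (by positivity)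
  have hi : IntegrableOn (fun x : ℝ => x ^ (d:ℝ) * Real.exp (-x ^ (2:ℝ))) (Ioi 0) := by
    by_contra hc
    rw [integral_undef hc] at h
    have : 0 < 1 / (2:ℝ) * Real.Gamma (((d:ℝ)+1)/2) := by positivity
    linarith
  rw [show Real.Gamma (((d:ℝ)+1)/2) / 2 = 1 / (2:ℝ) * Real.Gamma (((d:ℝ)+1)/2) by ring, ← h,
    ofReal_integral_eq_lintegral_ofReal hi]
  · refine setLIntegral_congr_fun measurableSet_Ioi fun t ht => ?_
    have ht' : (0:ℝ) < t := ht
    rw [← ENNReal.ofReal_mul (by positivity)]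
    congr 1
    rw [Real.rpow_natCast, Real.rpow_two, mul_comm]
  · filter_upwards [ae_restrict_mem measurableSet_Ioi] with t ht
    have ht' : (0:ℝ) < t := ht
    positivity

lemma gauss_coord {d : ℕ} (i : Fin d) :
    ∫⁻ h : Euc d, ENNReal.ofReal (Real.exp (-‖h‖^2)) * ENNReal.ofReal |h i|
     = ENNReal.ofReal (√Real.pi ^ (d-1)) := by
  have h1 : ∫ x : ℝ, |x| * Real.exp (-x^2) = 1 := by
    have := integral_comp_abs (f := fun x : ℝ => x * Real.exp (-x^2))
    simp only [sq_abs] at this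
    rw [this]
    have h := integral_rpow_mul_exp_neg_rpow (p := 2) (q := 1) (by norm_num) (by norm_num)
    norm_num at h
    rw [h]; norm_num
  have h2 : ∫ x : ℝ, Real.exp (-x^2) = √Real.pi := by
    simpa using integral_gaussian 1
  have hprod : ∫ h : Fin d → ℝ, ∏ j, (if j = i then |h j| * Real.exp (-(h j)^2)
      else Real.exp (-(h j)^2)) = √Real.pi ^ (d-1) := by
    rw [integral_fintype_prod_volume_eq_prod
      (f := fun j (x:ℝ) => if j = i then |x| * Real.exp (-x^2) else Real.exp (-x^2))]
    have : ∀ j, ∫ x : ℝ, (if j = i then |x| * Real.exp (-x^2) else Real.exp (-x^2))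
        = if j = i then 1 else √Real.pi := by
      intro j; split_ifs <;> assumption
    simp_rw [this]
    rw [Finset.prod_ite]
    simp [Finset.filter_ne', Finset.card_erase_of_mem]
  have hpos : 0 < √Real.pi ^ (d-1) := by positivity
  have hi : Integrable (fun h : Fin d → ℝ => ∏ j, (if j = i then |h j| * Real.exp (-(h j)^2)
      else Real.exp (-(h j)^2))) := by
    by_contra hc
    rw [integral_undef hc] at hprod
    linarith
  rw [← hprod, ofReal_integral_eq_lintegral_ofReal hi]
  · rw [← (PiLp.volume_preserving_toLp (Fin d)).lintegral_comp_emb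
      (MeasurableEquiv.toLp 2 (Fin d → ℝ)).measurableEmbedding]
    refine lintegral_congr fun h => ?_
    rw [← ENNReal.ofReal_mul (by positivity)]
    congr 1
    have : ∀ j, (if j = i then |h j| * Real.exp (-(h j)^2) else Real.exp (-(h j)^2))
      = (if j = i then |h j| else 1) * Real.exp (-(h j)^2) := by
      intro j; split_ifs <;> simp
    simp_rw [this]
    rw [Finset.prod_mul_distrib, ← Real.exp_sum, EuclideanSpace.norm_sq_eq, mul_comm]
    simp
  · refine .of_forall fun h => Finset.prod_nonneg fun j _ => ?_
    split_ifs <;> positivity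

lemma gauss_inner {d : ℕ} (hd : 1 ≤ d) (v : Euc d) :
    ∫⁻ h : Euc d, ENNReal.ofReal (Real.exp (-‖h‖^2)) * ENNReal.ofReal |@inner ℝ _ _ v h|
     = ENNReal.ofReal ‖v‖ * ENNReal.ofReal (√Real.pi ^ (d-1)) := by
  let i : Fin d := ⟨0, hd⟩
  let w : Euc d := EuclideanSpace.single i ‖v‖
  have hvw : ‖w‖ = ‖v‖ := by simp [w]
  let R := (ℝ ∙ (w - v))ᗮ.reflection
  have hR : R w = v := Submodule.reflection_sub hvw
  rw [← gauss_coord i, ← lintegral_const_mul _ (by fun_prop)]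
  rw [← (LinearIsometryEquiv.measurePreserving R).lintegral_comp_emb
    R.toHomeomorph.measurableEmbedding]
  refine lintegral_congr fun h => ?_
  have : @inner ℝ _ _ v (R h) = ‖v‖ * h i := by
    rw [← hR, LinearIsometryEquiv.inner_map_map, hR]
    simp [w, EuclideanSpace.inner_single_left]
  rw [LinearIsometryEquiv.norm_map, this, abs_mul, abs_norm, ENNReal.ofReal_mul (norm_nonneg _)]
  ring

lemma sphere_inner {d : ℕ} (hd : 2 ≤ d) (v : Euc d) :
    ∫⁻ θ : sphere (0 : Euc d) 1, ENNReal.ofReal |@inner ℝ _ _ v (θ : Euc d)|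
      ∂((volume : Measure (Euc d)).toSphere) = ENNReal.ofReal (2 * omegaB (d-1) * ‖v‖) := by
  have hpol := polar_hom (d := d) (by omega) (fun t => ENNReal.ofReal (Real.exp (-t^2)))
    (by fun_prop) (fun h => ENNReal.ofReal |@inner ℝ _ _ v h|) (by fun_prop) (by
      intro t x ht
      rw [inner_smul_right, abs_mul, abs_of_pos ht, ENNReal.ofReal_mul ht.le])
  rw [gauss_inner (by omega), gauss_lint] at hpol
  have hG : 0 < Real.Gamma (((d:ℝ)+1)/2) := Real.Gamma_pos_of_pos (by positivity)
  have hne : ENNReal.ofReal (Real.Gamma (((d:ℝ)+1)/2) / 2) ≠ 0 := by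
    simp; positivity
  have hom : omegaB (d-1) = √Real.pi ^ (d-1) / Real.Gamma (((d:ℝ)+1)/2) := by
    have : Nonempty (Fin (d-1)) := ⟨⟨0, by omega⟩⟩
    unfold omegaB
    rw [EuclideanSpace.volume_ball]
    have h1 : ((d - 1 : ℕ) : ℝ) / 2 + 1 = ((d:ℝ)+1)/2 := by
      rw [Nat.cast_sub (by omega)]; push_cast; ring
    simp only [Fintype.card_fin, h1]
    rw [ENNReal.ofReal_one, one_pow, one_mul, ENNReal.toReal_ofReal (by positivity)]
  rw [← ENNReal.mul_left_inj hne ENNReal.ofReal_ne_top, ← hpol,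
    ← ENNReal.ofReal_mul (norm_nonneg _), ← ENNReal.ofReal_mul' (by positivity), hom]
  congr 1
  field_simp

def Mint (d : ℕ) (s r a : ℝ) : ℝ≥0∞ :=
  ∫⁻ t in Ioi (0:ℝ), (Iio a).indicator (fun t => ENNReal.ofReal (ker d s r t)) t * ENNReal.ofReal (t ^ d)

lemma ker_meas (d : ℕ) (s r : ℝ) : Measurable (ker d s r) := by
  unfold _root_.ker
  exact Measurable.ite measurableSet_Iic (by fun_prop) (by fun_prop)

lemma ker_nonneg (d : ℕ) (s r t : ℝ) (hr : 0 < r) : 0 ≤ ker d s r t := by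
  unfold _root_.ker
  split_ifs with h
  · positivity
  · have : 0 < t := hr.trans (not_le.1 h)
    positivity

lemma Mint_eq (d : ℕ) (s r a : ℝ) (hr : 0 < r) (hra : r < a) :
    Mint d s r a = ENNReal.ofReal (r ^ (1 - s) / (d + 1) + ∫ t in r..a, t ^ (-s)) := by
  have ha : 0 < a := hr.trans hra
  have e1 : Mint d s r a = ∫⁻ t in Ioo 0 a, ENNReal.ofReal (ker d s r t * t ^ d) := by
    unfold Mint
    have : Ioo 0 a = Ioi 0 ∩ Iio a := rfl
    rw [this, inter_comm, ← Measure.restrict_restrict measurableSet_Iio,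
      ← lintegral_indicator measurableSet_Iio]
    refine lintegral_congr fun t => ?_
    by_cases h : t ∈ Iio a
    · simp [h, ENNReal.ofReal_mul (ker_nonneg d s r t hr)]
    · simp [h]
  have hunion : Ioo 0 a = Ioc 0 r ∪ Ioo r a := (Ioc_union_Ioo_eq_Ioo hr.le hra).symm
  have hdisj : Disjoint (Ioc 0 r) (Ioo r a) := by
    rw [Set.disjoint_left]
    intro t h1 h2
    exact absurd h2.1 (not_lt.2 h1.2)
  rw [e1, hunion, lintegral_union measurableSet_Ioo hdisj]
  have hI1 : ∫⁻ t in Ioc 0 r, ENNReal.ofReal (ker d s r t * t ^ d)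
      = ENNReal.ofReal (r ^ (1 - s) / (d + 1)) := by
    have : r ^ (1 - s) / (d + 1) = ∫ t in Ioc 0 r, r ^ (-((d : ℝ) + s)) * t ^ d := by
      rw [← intervalIntegral.integral_of_le hr.le, intervalIntegral.integral_const_mul, integral_pow]
      have : r ^ (1 - s) = r ^ (-((d : ℝ) + s)) * r ^ (d+1) := by
        rw [← Real.rpow_natCast r (d+1), ← Real.rpow_add hr]
        congr 1; push_cast; ring
      rw [this]; simp; ring
    rw [this, ofReal_integral_eq_lintegral_ofReal]
    · refine setLIntegral_congr_fun measurableSet_Ioc fun t ht => ?_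
      simp [_root_.ker, ht.2]
    · exact (Continuous.integrableOn_Icc (by fun_prop)).mono_set Ioc_subset_Icc_self
    · filter_upwards [ae_restrict_mem measurableSet_Ioc] with t ht
      have := ht.1
      positivity
  have hint : IntegrableOn (fun t : ℝ => t ^ (-s)) (Icc r a) := by
    refine ContinuousOn.integrableOn_Icc ?_
    intro t ht
    have : 0 < t := hr.trans_le ht.1
    exact (Real.continuousAt_rpow_const _ _ (Or.inl this.ne')).continuousWithinAt
  have hI2 : ∫⁻ t in Ioo r a, ENNReal.ofReal (ker d s r t * t ^ d)
      = ENNReal.ofReal (∫ t in r..a, t ^ (-s)) := by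
    rw [intervalIntegral.integral_of_le hra.le, Measure.restrict_congr_set Ioo_ae_eq_Ioc,
      ofReal_integral_eq_lintegral_ofReal (hint.mono_set Ioc_subset_Icc_self)]
    · refine setLIntegral_congr_fun measurableSet_Ioc fun t ht => ?_
      have : 0 < t := hr.trans ht.1
      simp only [_root_.ker, not_le.2 ht.1, if_false]
      rw [← Real.rpow_natCast t d, ← Real.rpow_add this]
      congr 2; ring
    · filter_upwards [ae_restrict_mem measurableSet_Ioc] with t ht
      have := hr.trans ht.1
      positivity
  rw [hI1, hI2, ← ENNReal.ofReal_add (by positivity)]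
  refine intervalIntegral.integral_nonneg hra.le fun t ht => ?_
  have : 0 < t := hr.trans_le ht.1
  positivity

lemma Mint_asymp (d : ℕ) (s : ℝ) (hs : 1 ≤ s) (r : ℕ → ℝ) (hrpos : ∀ n, 0 < r n)
    (hr0 : Tendsto r atTop (nhds 0)) (a : ℝ) (ha : 0 < a) (κ : ℝ) (hκ : κ < 1) :
    ∀ᶠ n in atTop, 0 < sgm d s (r n) ∧ ∃ m : ℝ, Mint d s (r n) a = ENNReal.ofReal m ∧
      κ * sgm d s (r n) ≤ m := by
  have hr0' : Tendsto r atTop (nhdsWithin 0 (Ioi 0)) :=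
    tendsto_nhdsWithin_iff.2 ⟨hr0, .of_forall hrpos⟩
  have hlt : ∀ᶠ n in atTop, r n < a := hr0.eventually_lt_const ha
  rcases hs.eq_or_lt with rfl | hs
  · have hlog : Tendsto (fun n => Real.log (r n)) atTop atBot :=
      Real.tendsto_log_nhdsGT_zero.comp hr0'
    filter_upwards [hlt, hlog.eventually_le_atBot (-1),
      hlog.eventually_le_atBot (Real.log a / (1 - κ))] with n h1 h2 h3
    have hsg : sgm d 1 (r n) = - Real.log (r n) := by
      simp [sgm, abs_of_nonpos (show Real.log (r n) ≤ 0 by linarith)]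
    rw [hsg]
    refine ⟨by linarith, _, Mint_eq d 1 _ a (hrpos n) h1, ?_⟩
    have hi : ∫ t in (r n)..a, t ^ (-(1:ℝ)) = Real.log a - Real.log (r n) := by
      simp_rw [Real.rpow_neg_one]
      rw [integral_inv_of_pos (hrpos n) ha, Real.log_div ha.ne' (hrpos n).ne']
    rw [hi, sub_self, Real.rpow_zero]
    have : (0:ℝ) ≤ 1 / ((d:ℝ)+1) := by positivity
    rw [le_div_iff₀ (by linarith)] at h3
    nlinarith
  · have hX : Tendsto (fun n => (r n) ^ (1 - s)) atTop atTop :=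
      (tendsto_rpow_neg_nhdsGT_zero (by linarith)).comp hr0'
    set C : ℝ := ((d:ℝ) + s) / (d + 1) with hC
    have hCpos : 0 < C := by positivity
    have hs1 : 0 < s - 1 := by linarith
    filter_upwards [hlt, hX.eventually_ge_atTop (a ^ (1 - s) / ((1 - κ) * C))] with n h1 h2
    have hXp : 0 < (r n) ^ (1 - s) := Real.rpow_pos_of_pos (hrpos n) _
    have hsg : sgm d s (r n) = C * (r n) ^ (1 - s) / (s - 1) := by
      simp [sgm, hs.ne', hC]
    rw [hsg]
    refine ⟨by positivity, _, Mint_eq d s _ a (hrpos n) h1, ?_⟩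
    have hi : ∫ t in (r n)..a, t ^ (-s) = ((r n) ^ (1 - s) - a ^ (1 - s)) / (s - 1) := by
      rw [integral_rpow]
      · rw [show -s + 1 = 1 - s by ring, ← neg_sub s 1, div_neg, ← neg_div, neg_sub]
      · right
        refine ⟨by linarith, ?_⟩
        rw [uIcc_of_le h1.le]
        exact fun h => absurd h.1 (not_le.2 (hrpos n))
    rw [hi]
    generalize (r n) ^ (1 - s) = X at *
    have hk : 0 < (1 - κ) * C := mul_pos (by linarith) hCpos
    rw [div_le_iff₀ hk] at h2
    have key : X / (d + 1) + (X - a ^ (1 - s)) / (s - 1) = (C * X - a ^ (1 - s)) / (s - 1) := by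
      rw [hC]; field_simp; ring
    rw [key, ← mul_div_assoc]
    gcongr
    nlinarith

/-- real characteristic function -/
def chi {d : ℕ} (F : Set (Euc d)) : Euc d → ℝ := F.indicator (fun _ => (1:ℝ))

lemma chi_meas {d : ℕ} {F : Set (Euc d)} (hF : MeasurableSet F) : Measurable (chi F) :=
  measurable_const.indicator hF

def gd {d : ℕ} (F : Set (Euc d)) (h : Euc d) : ℝ≥0∞ := ∫⁻ x, ‖chi F (x + h) - chi F x‖ₑ

lemma J_sym {d : ℕ} (s r : ℝ) {F : Set (Euc d)} (hF : MeasurableSet F) :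
    2 * Jt d s r F = ∫⁻ h, ENNReal.ofReal (_root_.ker d s r ‖h‖) * gd F h := by
  have hk := ker_meas d s r
  have hc := chi_meas hF
  have hcc := chi_meas hF.compl
  have e1 : Jt d s r F = ∫⁻ x, ∫⁻ y, ENNReal.ofReal (_root_.ker d s r (dist x y)) *
      (‖chi F x‖ₑ * ‖chi Fᶜ y‖ₑ) := by
    unfold Jt
    rw [← lintegral_indicator hF]
    refine lintegral_congr fun x => ?_
    by_cases hx : x ∈ F
    · simp only [indicator_of_mem hx]
      rw [← lintegral_indicator hF.compl]
      refine lintegral_congr fun y => ?_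
      by_cases hy : y ∈ F <;> simp [chi, hx, hy]
    · simp [chi, hx]
  have e2 : Jt d s r F = ∫⁻ x, ∫⁻ y, ENNReal.ofReal (_root_.ker d s r (dist x y)) *
      (‖chi F y‖ₑ * ‖chi Fᶜ x‖ₑ) := by
    rw [e1, lintegral_lintegral_swap (by fun_prop)]
    simp_rw [dist_comm]
  calc 2 * Jt d s r F = Jt d s r F + Jt d s r F := two_mul _
    _ = ∫⁻ x, ∫⁻ y, ENNReal.ofReal (_root_.ker d s r (dist x y)) * ‖chi F y - chi F x‖ₑ := by
        nth_rw 1 [e1]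
        rw [e2, ← lintegral_add_left (by fun_prop)]
        refine lintegral_congr fun x => ?_
        rw [← lintegral_add_left (by fun_prop)]
        refine lintegral_congr fun y => ?_
        rw [← mul_add]
        congr 1
        by_cases hx : x ∈ F <;> by_cases hy : y ∈ F <;> simp [chi, hx, hy]
    _ = ∫⁻ x, ∫⁻ h, ENNReal.ofReal (_root_.ker d s r ‖h‖) * ‖chi F (x + h) - chi F x‖ₑ := by
        refine lintegral_congr fun x => ?_
        rw [← lintegral_add_left_eq_self _ x]
        refine lintegral_congr fun h => ?_
        rw [dist_self_add_right]
    _ = _ := by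
        rw [lintegral_lintegral_swap (by fun_prop)]
        refine lintegral_congr fun h => ?_
        rw [lintegral_const_mul _ (by fun_prop), gd]

/-- hypotheses on mollifier and its gradient -/
structure Moll {d : ℕ} (ρ : Euc d → ℝ) (G : Euc d → Euc d) (L : ℝ) : Prop where
  nonneg : ∀ x, 0 ≤ ρ x
  cont : Continuous ρ
  supp : HasCompactSupport ρ
  int1 : ∫ x, ρ x = 1
  contG : Continuous G
  suppG : HasCompactSupport G
  L0 : 0 ≤ L
  taylor : ∀ y h, |ρ (y + h) - ρ y - @inner ℝ _ _ (G y) h| ≤ L * ‖h‖ ^ 2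

def vF {d : ℕ} (G : Euc d → Euc d) (F : Set (Euc d)) (x : Euc d) : Euc d := ∫ z in F, G (x - z)

lemma Moll.intG {d : ℕ} {ρ : Euc d → ℝ} {G : Euc d → Euc d} {L : ℝ} (H : Moll ρ G L) (x : Euc d) :
    Integrable (fun z => G (x - z)) :=
  (H.contG.integrable_of_hasCompactSupport H.suppG).comp_sub_left x

lemma Moll.intρ {d : ℕ} {ρ : Euc d → ℝ} {G : Euc d → Euc d} {L : ℝ} (H : Moll ρ G L) (x : Euc d) :
    Integrable (fun z => ρ (x - z)) :=
  (H.cont.integrable_of_hasCompactSupport H.supp).comp_sub_left x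

lemma vF_meas {d : ℕ} {ρ : Euc d → ℝ} {G : Euc d → Euc d} {L : ℝ} (H : Moll ρ G L)
    (F : Set (Euc d)) : Measurable (vF G F) := by
  have : StronglyMeasurable (fun p : Euc d × Euc d => G (p.1 - p.2)) :=
    (H.contG.comp (by fun_prop)).stronglyMeasurable
  exact this.integral_prod_right.measurable

lemma pointwise_est {d : ℕ} {ρ : Euc d → ℝ} {G : Euc d → Euc d} {L : ℝ} (H : Moll ρ G L)
    {F : Set (Euc d)} (hF : MeasurableSet F) (hFf : volume F < ⊤) (x h : Euc d) :
    ENNReal.ofReal |@inner ℝ _ _ (vF G F x) h| ≤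
      (∫⁻ z, ENNReal.ofReal (ρ (x - z)) * ‖chi F (z + h) - chi F z‖ₑ) +
        ENNReal.ofReal (L * ‖h‖ ^ 2) * volume F := by
  have : IsFiniteMeasure (volume.restrict F) := ⟨by simpa using hFf⟩
  have hc := chi_meas hF
  have i1 : Integrable (fun z => ρ (x - z + h)) := by
    have := H.intρ (x + h)
    simpa [add_sub_right_comm] using this
  have i2 := H.intρ x
  have iG : Integrable (fun z => @inner ℝ _ _ (G (x - z)) h) := (H.intG x).inner_const h
  have ichi : ∀ g : Euc d → ℝ, Integrable g → Integrable (fun z => chi F z * g z) := by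
    intro g hg
    refine hg.bdd_mul (c := 1) hc.aestronglyMeasurable (.of_forall fun z => ?_)
    by_cases hz : z ∈ F <;> simp [chi, hz]
  have ich : ∀ g : Euc d → ℝ, ∫ z in F, g z = ∫ z, chi F z * g z := by
    intro g
    rw [← integral_indicator hF]
    refine integral_congr_ae (.of_forall fun z => ?_)
    by_cases hz : z ∈ F <;> simp [chi, hz]
  have e0 : @inner ℝ _ _ (vF G F x) h = ∫ z in F, @inner ℝ _ _ (G (x - z)) h := by
    unfold vF
    rw [real_inner_comm, ← integral_inner (H.intG x).integrableOn]
    simp_rw [real_inner_comm]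
  have e1 : @inner ℝ _ _ (vF G F x) h = (∫ z in F, (ρ (x - z + h) - ρ (x - z)))
      - ∫ z in F, (ρ (x - z + h) - ρ (x - z) - @inner ℝ _ _ (G (x - z)) h) := by
    rw [e0, integral_sub (f := fun z => ρ (x - z + h) - ρ (x - z)) (i1.sub i2).integrableOn
      iG.integrableOn]
    ring
  have e2 : ∫ z in F, (ρ (x - z + h) - ρ (x - z)) =
      ∫ z, ρ (x - z) * (chi F (z + h) - chi F z) := by
    rw [integral_sub i1.integrableOn i2.integrableOn, ich, ich,
      ← integral_add_right_eq_self _ h, ← integral_sub _ (ichi _ i2)]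
    · refine integral_congr_ae (.of_forall fun z => ?_)
      simp only
      rw [show x - (z + h) + h = x - z by abel]
      ring
    · exact (ichi _ i1).comp_add_right h
  rw [e1, e2]
  refine (ENNReal.ofReal_le_ofReal (abs_sub _ _)).trans ?_
  rw [ENNReal.ofReal_add (abs_nonneg _) (abs_nonneg _)]
  refine add_le_add ?_ ?_
  · rw [← Real.enorm_eq_ofReal_abs]
    refine (enorm_integral_le_lintegral_enorm _).trans (le_of_eq ?_)
    refine lintegral_congr fun z => ?_
    rw [enorm_mul, Real.enorm_eq_ofReal (H.nonneg _)]
  · rw [← Real.enorm_eq_ofReal_abs]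
    refine (enorm_integral_le_lintegral_enorm _).trans ?_
    rw [← setLIntegral_const]
    refine lintegral_mono fun z => ?_
    rw [Real.enorm_eq_ofReal_abs]
    exact ENNReal.ofReal_le_ofReal (H.taylor _ _)

lemma integrated_est {d : ℕ} {ρ : Euc d → ℝ} {G : Euc d → Euc d} {L : ℝ} (H : Moll ρ G L)
    {F : Set (Euc d)} (hF : MeasurableSet F) (hFf : volume F < ⊤) (K : Set (Euc d)) (h : Euc d) :
    ∫⁻ x in K, ENNReal.ofReal |@inner ℝ _ _ (vF G F x) h| ≤
      gd F h + ENNReal.ofReal (L * ‖h‖ ^ 2) * volume F * volume K := by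
  have hc := chi_meas hF
  have hρ := H.cont.measurable
  calc _ ≤ ∫⁻ x in K, ((∫⁻ z, ENNReal.ofReal (ρ (x - z)) * ‖chi F (z + h) - chi F z‖ₑ) +
        ENNReal.ofReal (L * ‖h‖ ^ 2) * volume F) :=
        lintegral_mono fun x => pointwise_est H hF hFf x h
    _ = (∫⁻ x in K, (∫⁻ z, ENNReal.ofReal (ρ (x - z)) * ‖chi F (z + h) - chi F z‖ₑ)) +
        ENNReal.ofReal (L * ‖h‖ ^ 2) * volume F * volume K := by
        rw [lintegral_add_right _ measurable_const, setLIntegral_const]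
    _ ≤ (∫⁻ x, (∫⁻ z, ENNReal.ofReal (ρ (x - z)) * ‖chi F (z + h) - chi F z‖ₑ)) +
        ENNReal.ofReal (L * ‖h‖ ^ 2) * volume F * volume K := by
        gcongr
        exact Measure.restrict_le_self
    _ = _ := by
        congr 1
        rw [lintegral_lintegral_swap (by fun_prop), gd]
        refine lintegral_congr fun z => ?_
        rw [lintegral_mul_const _ (by fun_prop), lintegral_sub_right_eq_self (fun x => ENNReal.ofReal (ρ x)),
          ← ofReal_integral_eq_lintegral_ofReal (H.cont.integrable_of_hasCompactSupport H.supp)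
            (.of_forall H.nonneg), H.int1]
        simp

lemma main_est {d : ℕ} (hd : 2 ≤ d) {ρ : Euc d → ℝ} {G : Euc d → Euc d} {L : ℝ} (H : Moll ρ G L)
    {F : Set (Euc d)} (hF : MeasurableSet F) (hFf : volume F < ⊤) (K : Set (Euc d))
    (s r a : ℝ) :
    ENNReal.ofReal (2 * omegaB (d-1)) * Mint d s r a * ∫⁻ x in K, ‖vF G F x‖ₑ ≤
      2 * Jt d s r F + ENNReal.ofReal L * volume F * volume K * (ENNReal.ofReal a *
        ((volume : Measure (Euc d)).toSphere univ * Mint d s r a)) := by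
  have hk := ker_meas d s r
  have hv := vF_meas H F
  have hom0 : 0 ≤ omegaB (d-1) := ENNReal.toReal_nonneg
  set f : ℝ → ℝ≥0∞ := (Iio a).indicator (fun t => ENNReal.ofReal (_root_.ker d s r t)) with hf
  have hfm : Measurable f := Measurable.indicator (by fun_prop) measurableSet_Iio
  have hB : ∀ v : Euc d, ∫⁻ h, f ‖h‖ * ENNReal.ofReal |@inner ℝ _ _ v h| =
      ENNReal.ofReal (2 * omegaB (d-1) * ‖v‖) * Mint d s r a := by
    intro v
    rw [polar_hom (by omega) f hfm (fun h => ENNReal.ofReal |@inner ℝ _ _ v h|) (by fun_prop) (by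
      intro t x ht
      rw [inner_smul_right, abs_mul, abs_of_pos ht, ENNReal.ofReal_mul ht.le]), sphere_inner hd]
    rfl
  have hC : ∫⁻ h : Euc d, f ‖h‖ * ENNReal.ofReal ‖h‖ =
      (volume : Measure (Euc d)).toSphere univ * Mint d s r a := by
    rw [polar_hom (by omega) f hfm (fun h => ENNReal.ofReal ‖h‖) (by fun_prop) (by
      intro t x ht
      rw [norm_smul, Real.norm_of_nonneg ht.le, ENNReal.ofReal_mul ht.le])]
    congr 1
    simp
  have hfa : ∀ h : Euc d, f ‖h‖ * ENNReal.ofReal (L * ‖h‖ ^ 2) ≤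
      ENNReal.ofReal L * (ENNReal.ofReal a * (f ‖h‖ * ENNReal.ofReal ‖h‖)) := by
    intro h
    by_cases hh : ‖h‖ < a
    · rw [ENNReal.ofReal_mul H.L0, sq, ENNReal.ofReal_mul (norm_nonneg _)]
      calc _ = ENNReal.ofReal L * (ENNReal.ofReal ‖h‖ * (f ‖h‖ * ENNReal.ofReal ‖h‖)) := by ring
        _ ≤ _ := by gcongr
    · simp [hf, hh]
  calc _ = ∫⁻ x in K, ∫⁻ h, f ‖h‖ * ENNReal.ofReal |@inner ℝ _ _ (vF G F x) h| := by
        simp_rw [hB]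
        rw [← lintegral_const_mul _ (by fun_prop)]
        refine lintegral_congr fun x => ?_
        rw [ENNReal.ofReal_mul (q := ‖vF G F x‖) (by positivity), ofReal_norm]
        ring
    _ = ∫⁻ h, f ‖h‖ * ∫⁻ x in K, ENNReal.ofReal |@inner ℝ _ _ (vF G F x) h| := by
        rw [lintegral_lintegral_swap (by fun_prop)]
        refine lintegral_congr fun h => ?_
        rw [lintegral_const_mul _ (by fun_prop)]
    _ ≤ ∫⁻ h, (ENNReal.ofReal (_root_.ker d s r ‖h‖) * gd F h + ENNReal.ofReal L * volume F * volume K *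
          (ENNReal.ofReal a * (f ‖h‖ * ENNReal.ofReal ‖h‖))) := by
        refine lintegral_mono fun h => ?_
        refine (mul_le_mul_right (integrated_est H hF hFf K h) _).trans ?_
        rw [mul_add]
        refine add_le_add ?_ ?_
        · gcongr
          exact indicator_le_self _ _ _
        · calc _ = (f ‖h‖ * ENNReal.ofReal (L * ‖h‖ ^ 2)) * (volume F * volume K) := by ring
            _ ≤ _ := mul_le_mul_left (hfa h) _
            _ = _ := by ring
    _ = _ := by
        rw [lintegral_add_right _ (by fun_prop), J_sym s r hF, lintegral_const_mul _ (by fun_prop),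
          lintegral_const_mul _ (by fun_prop), hC]

lemma exists_moll (d : ℕ) (δ : ℝ) (hδ : 0 < δ) : ∃ (ρ : Euc d → ℝ) (G : Euc d → Euc d) (L : ℝ),
    Moll ρ G L ∧ ContDiff ℝ 1 ρ ∧ (∀ x, δ ≤ ‖x‖ → ρ x = 0) ∧
    ∀ y h, fderiv ℝ ρ y h = @inner ℝ _ _ (G y) h := by
  let φ : ContDiffBump (0 : Euc d) := ⟨δ / 2, δ, by linarith, by linarith⟩
  let ρ : Euc d → ℝ := φ.normed volume
  have hρ2 : ContDiff ℝ 2 ρ := φ.contDiff_normed (n := 2)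
  have hρ1 : ContDiff ℝ 1 ρ := hρ2.of_le (by norm_num)
  have hsupp : HasCompactSupport ρ := φ.hasCompactSupport_normed
  have hD : ContDiff ℝ 1 (fderiv ℝ ρ) := hρ2.fderiv_right (by norm_num)
  have hDs : HasCompactSupport (fderiv ℝ ρ) := hsupp.fderiv (𝕜 := ℝ)
  obtain ⟨C, hC⟩ := hD.lipschitzWith_of_hasCompactSupport hDs (by norm_num)
  let G : Euc d → Euc d := fun y => (InnerProductSpace.toDual ℝ (Euc d)).symm (fderiv ℝ ρ y)
  have hG : ∀ y h, fderiv ℝ ρ y h = @inner ℝ _ _ (G y) h := by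
    intro y h
    simp only [G]
    rw [InnerProductSpace.toDual_symm_apply]
  refine ⟨ρ, G, C, ⟨fun x => φ.nonneg_normed x, hρ1.continuous, hsupp, φ.integral_normed, ?_, ?_,
    C.2, ?_⟩, hρ1, ?_, hG⟩
  · exact (LinearIsometryEquiv.continuous _).comp hD.continuous
  · exact hDs.comp_left (g := fun l => (InnerProductSpace.toDual ℝ (Euc d)).symm l) (map_zero _)
  · intro y h
    rw [← hG, ← Real.norm_eq_abs]
    have := (convex_closedBall y ‖h‖).norm_image_sub_le_of_norm_fderiv_le' (𝕜 := ℝ) (f := ρ)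
      (φ := fderiv ℝ ρ y) (C := C * ‖h‖) (x := y) (y := y + h)
      (fun x _ => (hρ1.differentiable (by norm_num)) x) (by
        intro x hx
        rw [← dist_eq_norm]
        refine (hC.dist_le_mul x y).trans ?_
        gcongr
        exact hx) (by simp) (by simp)
    rw [add_sub_cancel_left] at this
    rw [sq, ← mul_assoc]
    exact this
  · intro x hx
    by_contra hne
    have : x ∈ Function.support (φ.normed volume) := hne
    rw [φ.support_normed_eq] at this
    simp [φ] at this
    linarith

lemma diverg_cont {d : ℕ} {Φ : Euc d → Euc d} (h1 : ContDiff ℝ 1 Φ) : Continuous (diverg Φ) := by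
  unfold diverg
  have := h1.continuous_fderiv (by norm_num)
  refine continuous_finsetSum _ fun i _ => ?_
  have h2 : Continuous fun x => fderiv ℝ Φ x (EuclideanSpace.single i 1) := this.clm_apply continuous_const
  fun_prop

lemma diverg_supp {d : ℕ} {Φ : Euc d → Euc d} (h2 : HasCompactSupport Φ) :
    HasCompactSupport (diverg Φ) := by
  unfold diverg
  exact (h2.fderiv (𝕜 := ℝ)).comp_left
    (g := fun l : Euc d →L[ℝ] Euc d => ∑ i : Fin d, l (EuclideanSpace.single i 1) i) (by simp)

lemma ibp {d : ℕ} {ρ : Euc d → ℝ} {G : Euc d → Euc d} {L : ℝ} (H : Moll ρ G L)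
    (hρ : ContDiff ℝ 1 ρ) (hG : ∀ y h, fderiv ℝ ρ y h = @inner ℝ _ _ (G y) h)
    {Φ : Euc d → Euc d} (h1 : ContDiff ℝ 1 Φ) (h2 : HasCompactSupport Φ) (z : Euc d) :
    ∫ x, ρ (x - z) * diverg Φ x = - ∫ x, @inner ℝ _ _ (G (x - z)) (Φ x) := by
  have hf : ContDiff ℝ 1 (fun x => ρ (x - z)) := hρ.comp (contDiff_id.sub contDiff_const)
  have hfd : ∀ x v, fderiv ℝ (fun x => ρ (x - z)) x v = @inner ℝ _ _ (G (x - z)) v := by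
    intro x v
    rw [fderiv_comp_sub, hG]
  have hc : ∀ i, ContDiff ℝ 1 (fun x => Φ x i) := fun i => by fun_prop
  have hcd : ∀ i x v, fderiv ℝ (fun x => Φ x i) x v = fderiv ℝ Φ x v i := by
    intro i x v
    have hd : HasFDerivAt Φ (fderiv ℝ Φ x) x := (h1.differentiable (by norm_num) x).hasFDerivAt
    have := ((EuclideanSpace.proj i : Euc d →L[ℝ] ℝ).hasFDerivAt (x := Φ x)).comp x hd
    have e : fderiv ℝ (fun x => Φ x i) x = _ := this.fderiv
    rw [e]; rfl
  have hs : ∀ i, HasCompactSupport (fun x => Φ x i) := fun i =>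
    h2.comp_left (g := fun y : Euc d => y i) (by simp)
  have hfc : Continuous (fun x => ρ (x - z)) := hf.continuous
  have hGc : Continuous (fun x => G (x - z)) := H.contG.comp (by fun_prop)
  have hcont : ∀ i (v : Euc d), Continuous fun x => fderiv ℝ (fun x => Φ x i) x v := fun i v =>
    ((hc i).continuous_fderiv (by norm_num)).clm_apply continuous_const
  have hdsupp : ∀ i (v : Euc d), HasCompactSupport fun x => fderiv ℝ (fun x => Φ x i) x v := fun i v =>
    ((hs i).fderiv (𝕜 := ℝ)).comp_left (g := fun l : Euc d →L[ℝ] ℝ => l v) (by simp)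
  have I1 : ∀ i, Integrable (fun x => ρ (x - z) * fderiv ℝ (fun x => Φ x i) x (EuclideanSpace.single i 1)) :=
    fun i => (hfc.mul (hcont i _)).integrable_of_hasCompactSupport (hdsupp i _).mul_left
  have I2 : ∀ i, Integrable (fun x => fderiv ℝ (fun x => ρ (x - z)) x (EuclideanSpace.single i 1) * Φ x i) := by
    intro i
    refine Continuous.integrable_of_hasCompactSupport ?_ (hs i).mul_left
    simp_rw [hfd]
    exact (hGc.inner continuous_const).mul (hc i).continuous
  have I3 : ∀ i, Integrable (fun x => ρ (x - z) * Φ x i) := fun i =>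
    (hfc.mul (hc i).continuous).integrable_of_hasCompactSupport (hs i).mul_left
  have key : ∀ i, ∫ x, ρ (x - z) * fderiv ℝ (fun x => Φ x i) x (EuclideanSpace.single i 1) =
      - ∫ x, fderiv ℝ (fun x => ρ (x - z)) x (EuclideanSpace.single i 1) * Φ x i := fun i =>
    integral_mul_fderiv_eq_neg_fderiv_mul_of_integrable (I2 i) (I1 i) (I3 i)
      (fun x _ => hf.differentiable (by norm_num) x) (fun x _ => (hc i).differentiable (by norm_num) x)
  calc ∫ x, ρ (x - z) * diverg Φ x
      = ∫ x, ∑ i, ρ (x - z) * fderiv ℝ (fun x => Φ x i) x (EuclideanSpace.single i 1) := by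
        simp_rw [diverg, Finset.mul_sum, hcd]
    _ = ∑ i, - ∫ x, fderiv ℝ (fun x => ρ (x - z)) x (EuclideanSpace.single i 1) * Φ x i := by
        rw [integral_finsetSum _ fun i _ => I1 i]
        exact Finset.sum_congr rfl fun i _ => key i
    _ = - ∫ x, @inner ℝ _ _ (G (x - z)) (Φ x) := by
        rw [Finset.sum_neg_distrib, ← integral_finsetSum _ fun i _ => I2 i]
        congr 1
        refine integral_congr_ae (.of_forall fun x => ?_)
        simp only [hfd]
        rw [PiLp.inner_apply]
        refine Finset.sum_congr rfl fun i _ => ?_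
        rw [EuclideanSpace.inner_single_right]
        simp [mul_comm]

lemma lower_v {d : ℕ} {ρ : Euc d → ℝ} {G : Euc d → Euc d} {L : ℝ} (H : Moll ρ G L)
    (hρ : ContDiff ℝ 1 ρ) (hG : ∀ y h, fderiv ℝ ρ y h = @inner ℝ _ _ (G y) h)
    {Φ : Euc d → Euc d} (h1 : ContDiff ℝ 1 Φ) (h2 : HasCompactSupport Φ) (h3 : ∀ x, ‖Φ x‖ ≤ 1)
    {F : Set (Euc d)} (hFf : volume F < ⊤) :
    ENNReal.ofReal (∫ z in F, ∫ x, ρ (x - z) * diverg Φ x) ≤ ∫⁻ x in tsupport Φ, ‖vF G F x‖ₑ := by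
  have : IsFiniteMeasure (volume.restrict F) := ⟨by simpa using hFf⟩
  obtain ⟨C, hC⟩ := H.contG.bounded_above_of_compact_support H.suppG
  have hint : Integrable (fun p : Euc d × Euc d => @inner ℝ _ _ (G (p.1 - p.2)) (Φ p.1))
      (volume.prod (volume.restrict F)) := by
    have hΦ : Integrable (fun x => C * ‖Φ x‖) :=
      (h1.continuous.integrable_of_hasCompactSupport h2).norm.const_mul C
    have := hΦ.mul_prod (integrable_const (μ := volume.restrict F) (1:ℝ))
    refine this.mono' ?_ (.of_forall fun p => ?_)
    · have := H.contG
      have := h1.continuous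
      exact Continuous.aestronglyMeasurable (by fun_prop)
    · refine (norm_inner_le_norm _ _).trans ?_
      rw [mul_one]
      gcongr
      exact hC _
  have e : ∫ z in F, ∫ x, ρ (x - z) * diverg Φ x = - ∫ x, @inner ℝ _ _ (vF G F x) (Φ x) := by
    simp_rw [ibp H hρ hG h1 h2]
    rw [integral_neg, ← integral_integral_swap hint]
    congr 1
    refine integral_congr_ae (.of_forall fun x => ?_)
    simp only [vF]
    rw [real_inner_comm, ← integral_inner (H.intG x).integrableOn]
    simp_rw [real_inner_comm]
  rw [e]
  refine (ENNReal.ofReal_le_ofReal (neg_le_abs _)).trans ?_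
  rw [← Real.enorm_eq_ofReal_abs]
  refine (enorm_integral_le_lintegral_enorm _).trans ?_
  rw [← lintegral_indicator (isClosed_tsupport Φ).measurableSet]
  refine lintegral_mono fun x => ?_
  by_cases hx : x ∈ tsupport Φ
  · rw [indicator_of_mem hx, ← ofReal_norm, ← ofReal_norm]
    refine ENNReal.ofReal_le_ofReal ((norm_inner_le_norm _ _).trans ?_)
    exact mul_le_of_le_one_right (norm_nonneg _) (h3 x)
  · have : Φ x = 0 := image_eq_zero_of_notMem_tsupport hx
    simp [this]

lemma moll_close {d : ℕ} {ρ : Euc d → ℝ} {G : Euc d → Euc d} {L : ℝ} (H : Moll ρ G L) {δ η : ℝ}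
    (hs : ∀ x, δ ≤ ‖x‖ → ρ x = 0) {D : Euc d → ℝ} (hD : Continuous D)
    (hη : ∀ x z, dist x z < δ → |D x - D z| ≤ η) (z : Euc d) :
    D z - η ≤ ∫ x, ρ (x - z) * D x := by
  have hc : Continuous (fun x => ρ (x - z)) := H.cont.comp (by fun_prop)
  have hi0 : Integrable (fun x => ρ (x - z)) :=
    (H.cont.integrable_of_hasCompactSupport H.supp).comp_sub_right z
  have hcs : HasCompactSupport (fun x => ρ (x - z)) :=
    H.supp.comp_homeomorph (Homeomorph.subRight z)
  have e1 : ∫ x, ρ (x - z) = 1 := by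
    rw [integral_sub_right_eq_self (fun x => ρ x), H.int1]
  calc D z - η = ∫ x, ρ (x - z) * (D z - η) := by
        rw [integral_mul_const, e1, one_mul]
    _ ≤ _ := by
        refine integral_mono (hi0.mul_const _)
          ((hc.mul hD).integrable_of_hasCompactSupport hcs.mul_right) fun x => ?_
        simp only
        by_cases hx : δ ≤ ‖x - z‖
        · simp [hs _ hx]
        · have := hη x z (by rw [dist_eq_norm]; exact not_le.1 hx)
          have := abs_le.1 this
          exact mul_le_mul_of_nonneg_left (by linarith) (H.nonneg _)

lemma setInt_diff {d : ℕ} {D : Euc d → ℝ} (hDi : Integrable D) {B : ℝ} (hB : ∀ x, ‖D x‖ ≤ B)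
    {E F : Set (Euc d)} (hE : MeasurableSet E) (hF : MeasurableSet F) (hEf : volume E < ⊤)
    (hFf : volume F < ⊤) :
    (∫ x in E, D x) - 2 * B * (volume (F ∆ E)).toReal ≤ ∫ x in F, D x := by
  have hB0 : 0 ≤ B := (norm_nonneg _).trans (hB 0)
  have hfin : volume (F ∆ E) < ⊤ :=
    (measure_mono symmDiff_subset_union).trans_lt ((measure_union_le _ _).trans_lt
      (ENNReal.add_lt_top.2 ⟨hFf, hEf⟩))
  have e1 := integral_inter_add_sdiff (μ := volume) (f := D) (s := E) hF hDi.integrableOn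
  have e2 := integral_inter_add_sdiff (μ := volume) (f := D) (s := F) hE hDi.integrableOn
  rw [inter_comm] at e2
  have hle1 : E \ F ⊆ F ∆ E := fun x hx => Or.inr hx
  have hle2 : F \ E ⊆ F ∆ E := fun x hx => Or.inl hx
  have b : ∀ A : Set (Euc d), A ⊆ F ∆ E → |∫ x in A, D x| ≤ B * (volume (F ∆ E)).toReal := by
    intro A hA
    have := norm_setIntegral_le_of_norm_le_const (μ := volume) (f := D) (s := A) (C := B)
      ((measure_mono hA).trans_lt hfin) (fun x _ => hB x)
    refine this.trans ?_
    gcongr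
    exact ENNReal.toReal_mono hfin.ne (measure_mono hA)
  have b1 := abs_le.1 (b _ hle1)
  have b2 := abs_le.1 (b _ hle2)
  linarith [b1.1, b1.2, b2.1, b2.2]

lemma liminf_aux (d : ℕ) (hd : 2 ≤ d) (s : ℝ) (hs : 1 ≤ s)
    (r : ℕ → ℝ) (hrpos : ∀ n, 0 < r n) (hr0 : Tendsto r atTop (nhds 0))
    (E : Set (Euc d)) (hEmeas : MeasurableSet E) (hEfin : volume E < ⊤)
    (En : ℕ → Set (Euc d)) (hEnmeas : ∀ n, MeasurableSet (En n))
    (hEnfin : ∀ n, volume (En n) < ⊤)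
    (hconv : Tendsto (fun n => volume ((En n) ∆ E)) atTop (nhds 0))
    (Φ : Euc d → Euc d) (h1 : ContDiff ℝ 1 Φ) (h2 : HasCompactSupport Φ) (h3 : ∀ x, ‖Φ x‖ ≤ 1)
    (c : ℝ) (hc0 : 0 ≤ c) (hc : c < ∫ x in E, diverg Φ x) (hω : 0 < omegaB (d-1)) :
    ∀ᶠ n in atTop, ENNReal.ofReal (omegaB (d-1) * c) ≤
      Jt d s (r n) (En n) / ENNReal.ofReal (sgm d s (r n)) := by
  set ω := omegaB (d-1)
  set P := ∫ x in E, diverg Φ x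
  set D := diverg Φ
  have hDc : Continuous D := diverg_cont h1
  have hDs : HasCompactSupport D := diverg_supp h2
  have hDi : Integrable D := hDc.integrable_of_hasCompactSupport hDs
  obtain ⟨B, hB⟩ := hDc.bounded_above_of_compact_support hDs
  have hB0 : 0 ≤ B := (norm_nonneg _).trans (hB 0)
  set V : ℝ := (volume E).toReal + 1
  have hV : 0 < V := by positivity
  set q := P - c with hq
  have hq0 : 0 < q := by linarith
  set η := q / (4 * V) with hη
  have hη0 : 0 < η := by positivity
  have hηV : η * V = q / 4 := by rw [hη]; field_simp
  obtain ⟨δ, hδ, hδD⟩ := Metric.uniformContinuous_iff.1 (hDs.uniformContinuous_of_continuous hDc) η hη0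
  obtain ⟨ρ, G, L, H, hρ, hsupp, hG⟩ := exists_moll d δ hδ
  set k : ℝ := (volume (tsupport Φ)).toReal
  have hkf : volume (tsupport Φ) ≠ ⊤ := h2.measure_lt_top.ne
  set S : ℝ := ((volume : Measure (Euc d)).toSphere univ).toReal
  have hSf : (volume : Measure (Euc d)).toSphere univ ≠ ⊤ := measure_ne_top _ _
  set C : ℝ := L * V * k * S
  have hL := H.L0
  have hk0 : 0 ≤ k := ENNReal.toReal_nonneg
  have hS0 : 0 ≤ S := ENNReal.toReal_nonneg
  have hC0 : 0 ≤ C := by positivity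
  set a : ℝ := ω * q / (2 * (C + 1)) with ha
  have ha0 : 0 < a := by positivity
  have hCa : C * a ≤ ω * q / 2 := by
    rw [ha, ← mul_div_assoc, div_le_div_iff₀ (by positivity) (by positivity)]
    have : 0 < ω * q := by positivity
    nlinarith
  set κ : ℝ := c / (c + q / 4) with hκ
  have hκ1 : κ < 1 := by
    rw [hκ, div_lt_one (by positivity)]; linarith
  have hκe : κ * (c + q / 4) = c := by
    rw [hκ]; field_simp
  have hconv' : Tendsto (fun n => (volume ((En n) ∆ E)).toReal) atTop (nhds 0) := by
    have := (ENNReal.tendsto_toReal (ENNReal.zero_ne_top)).comp hconv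
    simpa [Function.comp_def] using this
  filter_upwards [Mint_asymp d s hs r hrpos hr0 a ha0 κ hκ1, hconv'.eventually_le_const one_pos,
    hconv'.eventually_le_const (show 0 < q / (8 * (B + 1)) by positivity)] with n hM hn1 hn2
  obtain ⟨hσ, m, hm, hκm⟩ := hM
  set σ := sgm d s (r n)
  set F := En n
  have hFf := hEnfin n
  have hFm := hEnmeas n
  set ε := (volume (F ∆ E)).toReal
  have hε0 : 0 ≤ ε := ENNReal.toReal_nonneg
  have hfin : volume (F ∆ E) < ⊤ :=
    (measure_mono symmDiff_subset_union).trans_lt ((measure_union_le _ _).trans_lt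
      (ENNReal.add_lt_top.2 ⟨hFf, hEfin⟩))
  have hFV : (volume F).toReal ≤ V := by
    have hsub : F ⊆ E ∪ F ∆ E := fun x hx => by
      by_cases hxE : x ∈ E
      · exact Or.inl hxE
      · exact Or.inr (Or.inl ⟨hx, hxE⟩)
    have := ENNReal.toReal_mono (ENNReal.add_lt_top.2 ⟨hEfin, hfin⟩).ne
      ((measure_mono hsub).trans (measure_union_le _ _))
    rw [ENNReal.toReal_add hEfin.ne hfin.ne] at this
    exact this.trans (by simp only [V]; linarith)
  set I := ∫ z in F, ∫ x, ρ (x - z) * D x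
  have hm0 : 0 ≤ m := le_trans (by positivity) hκm
  have hI : c + q / 2 ≤ I := by
    have hsd : P - 2 * B * ε ≤ ∫ x in F, D x := setInt_diff hDi hB hEmeas hFm hEfin hFf
    have hBε : 2 * B * ε ≤ q / 4 := by
      rw [le_div_iff₀ (by positivity)] at hn2
      nlinarith
    have hmol : (∫ z in F, D z) - η * (volume F).toReal ≤ I := by
      have : IsFiniteMeasure (volume.restrict F) := ⟨by simpa using hFf⟩
      have e : ∫ z in F, (D z - η) = (∫ z in F, D z) - η * (volume F).toReal := by
        rw [integral_sub hDi.integrableOn (integrable_const _)]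
        simp [Measure.real, mul_comm]
      rw [← e]
      refine integral_mono (hDi.integrableOn.sub (integrable_const _)) ?_ fun z =>
        moll_close H hsupp hDc (fun x z h => (hδD h).le) z
      have hmeas : StronglyMeasurable (fun p : Euc d × Euc d => ρ (p.2 - p.1) * D p.2) := by
        have := H.cont
        exact Continuous.stronglyMeasurable (by fun_prop)
      refine Integrable.mono' (integrable_const (∫ x, ‖ρ x‖ * B))
        hmeas.integral_prod_right.aestronglyMeasurable (.of_forall fun z => ?_)
      refine (norm_integral_le_integral_norm _).trans ?_
      rw [← integral_sub_right_eq_self (fun x => ‖ρ x‖ * B) z]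
      have hρi : Integrable (fun x => ρ (x - z)) :=
        (H.cont.integrable_of_hasCompactSupport H.supp).comp_sub_right z
      refine integral_mono_of_nonneg (.of_forall fun x => norm_nonneg _) (hρi.norm.mul_const B)
        (.of_forall fun x => ?_)
      simp only [norm_mul]
      gcongr
      exact hB x
    have : η * (volume F).toReal ≤ q / 4 := by
      rw [← hηV]; gcongr
    linarith
  rw [ENNReal.le_div_iff_mul_le (Or.inl (by simpa using hσ)) (Or.inl ENNReal.ofReal_ne_top)]
  by_cases hJ : Jt d s (r n) F = ⊤
  · rw [hJ]; exact le_top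
  have hmain := main_est hd H hFm hFf (tsupport Φ) s (r n) a
  have hlow := lower_v H hρ hG h1 h2 h3 hFf
  have hI0 : 0 ≤ I := le_trans (by positivity) hI
  have hreal : 2 * ω * m * I ≤ 2 * (Jt d s (r n) F).toReal + C * a * m := by
    have hchain : ENNReal.ofReal (2 * ω * m * I) ≤
        ENNReal.ofReal (2 * (Jt d s (r n) F).toReal + C * a * m) := by
      calc ENNReal.ofReal (2 * ω * m * I)
          = ENNReal.ofReal (2 * ω) * Mint d s (r n) a * ENNReal.ofReal I := by
            rw [hm, ← ENNReal.ofReal_mul (by positivity), ← ENNReal.ofReal_mul (by positivity)]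
        _ ≤ _ := mul_le_mul_right hlow _
        _ ≤ _ := hmain
        _ ≤ 2 * Jt d s (r n) F + ENNReal.ofReal L * ENNReal.ofReal V * ENNReal.ofReal k *
              (ENNReal.ofReal a * (ENNReal.ofReal S * ENNReal.ofReal m)) := by
            rw [hm, ENNReal.ofReal_toReal hkf, ENNReal.ofReal_toReal hSf]
            gcongr
            rw [← ENNReal.ofReal_toReal hFf.ne]
            exact ENNReal.ofReal_le_ofReal hFV
        _ = _ := by
            rw [ENNReal.ofReal_add (p := 2 * (Jt d s (r n) F).toReal) (by positivity) (by positivity),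
              ENNReal.ofReal_mul (p := 2) (by norm_num), ENNReal.ofReal_toReal hJ]
            rw [← ENNReal.ofReal_mul hL, ← ENNReal.ofReal_mul (by positivity),
              ← ENNReal.ofReal_mul hS0, ← ENNReal.ofReal_mul (by positivity),
              ← ENNReal.ofReal_mul (by positivity)]
            congr 2
            · simp
            · simp only [C]; ring
    exact (ENNReal.ofReal_le_ofReal_iff (by positivity)).1 hchain
  rw [← ENNReal.ofReal_mul (by positivity), ← ENNReal.ofReal_toReal hJ]
  refine ENNReal.ofReal_le_ofReal ?_
  have s1 : ω * m * (c + q / 2) ≤ ω * m * I := by gcongr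
  have s2 : C * a * m ≤ ω * q / 2 * m := by gcongr
  have s3 : κ * σ * (ω * (c + q / 4)) ≤ m * (ω * (c + q / 4)) := by gcongr
  have s4 : κ * σ * (ω * (c + q / 4)) = ω * c * σ := by
    calc _ = ω * (κ * (c + q / 4)) * σ := by ring
      _ = _ := by rw [hκe]
  linarith

/-- **Γ-liminf inequality.** For any sequence `r_n → 0⁺` and any sequence of
finite-measure sets `E_n` with `χ_{E_n} → χ_E` in `L¹(ℝ^d)`,
`ω_{d-1}·Per(E) ≤ liminf_n J̃_{r_n}^s(E_n)/σ^s(r_n)` (inequality in `[0,+∞]`). -/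
theorem stmt3 (d : ℕ) (hd : 2 ≤ d) (s : ℝ) (hs : 1 ≤ s)
    (r : ℕ → ℝ) (hrpos : ∀ n, 0 < r n) (hr0 : Tendsto r atTop (nhds 0))
    (E : Set (Euc d)) (hEmeas : MeasurableSet E) (hEfin : volume E < ⊤)
    (En : ℕ → Set (Euc d)) (hEnmeas : ∀ n, MeasurableSet (En n))
    (hEnfin : ∀ n, volume (En n) < ⊤)
    (hconv : Tendsto (fun n => volume ((En n) ∆ E)) atTop (nhds 0)) :
    ENNReal.ofReal (omegaB (d - 1)) * Per d E ≤
      Filter.liminf (fun n => Jt d s (r n) (En n) / ENNReal.ofReal (sgm d s (r n))) atTop := by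
  have hω : 0 < omegaB (d-1) :=
    ENNReal.toReal_pos (measure_ball_pos _ _ one_pos).ne' measure_ball_lt_top.ne
  unfold Per
  simp only [ENNReal.mul_iSup]
  refine iSup_le fun Φ => iSup_le fun h1 => iSup_le fun h2 => iSup_le fun h3 => ?_
  refine le_of_forall_lt fun x hx => ?_
  rw [← ENNReal.ofReal_mul hω.le] at hx
  obtain ⟨y, hxy, hy⟩ := exists_between hx
  refine hxy.trans_le ?_
  have hyt : y ≠ ⊤ := (hy.trans ENNReal.ofReal_lt_top).ne
  have hy' : y.toReal < omegaB (d-1) * ∫ x in E, diverg Φ x :=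
    (ENNReal.lt_ofReal_iff_toReal_lt hyt).1 hy
  have hc : y.toReal / omegaB (d-1) < ∫ x in E, diverg Φ x := by
    rw [div_lt_iff₀ hω]; linarith
  have := liminf_aux d hd s hs r hrpos hr0 E hEmeas hEfin En hEnmeas hEnfin hconv Φ h1 h2 h3
    (y.toReal / omegaB (d-1)) (by positivity) hc hω
  rw [mul_div_cancel₀ _ hω.ne', ENNReal.ofReal_toReal hyt] at this
  exact le_liminf_of_le (by isBoundedDefault) this

end
end

section
/- Let d ≥ 2 and let 0 < r < l be such that ω_d·r^d < l^d/4. Then for every ξ ∈ ℝ^d and every measurable set E ⊆ ℝ^d of finite Lebesgue measure, (1/l^d)·|(lQ+ξ)∖E|·|(lQ+ξ)∩E| ≤ ∫_{lQ+ξ} | χ_E(x) − (1/|(lQ+ξ)∖B(x,r)|) ∫_{(lQ+ξ)∖B(x,r)} χ_E(y) dy | dx. -/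
open MeasureTheory Filter Set Metric
open scoped ENNReal NNReal symmDiff

noncomputable section

theorem aux_cube_eq (d : ℕ) (l : ℝ) (ξ : Euc d) :
    cube d l ξ = (MeasurableEquiv.toLp 2 (Fin d → ℝ)).symm ⁻¹'
      (Set.pi univ fun i => Set.Ico (ξ i - l / 2) (ξ i + l / 2)) := by
  ext x
  simp [cube, Set.mem_pi]

theorem aux_cube_meas (d : ℕ) (l : ℝ) (ξ : Euc d) : MeasurableSet (cube d l ξ) := by
  rw [aux_cube_eq]
  exact (MeasurableEquiv.measurable _) (MeasurableSet.univ_pi fun i => measurableSet_Ico)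

theorem aux_cube_vol (d : ℕ) (l : ℝ) (hl : 0 < l) (ξ : Euc d) :
    volume (cube d l ξ) = ENNReal.ofReal (l ^ d) := by
  rw [aux_cube_eq, (EuclideanSpace.volume_preserving_symm_measurableEquiv_toLp
    (Fin d)).measure_preimage_equiv, Real.volume_pi_Ico]
  simp only [add_sub_sub_cancel, add_halves, Finset.prod_const, Finset.card_univ, Fintype.card_fin]
  rw [ENNReal.ofReal_pow hl.le]

theorem aux_ball_vol (d : ℕ) (r : ℝ) (hr : 0 < r) (x : Euc d) :
    volume (ball x r) = ENNReal.ofReal (omegaB d * r ^ d) := by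
  rw [Measure.addHaar_ball_of_pos _ _ hr, omegaB, mul_comm, ENNReal.ofReal_mul ENNReal.toReal_nonneg,
    ENNReal.ofReal_toReal measure_ball_lt_top.ne]
  simp

theorem aux_swap {d : ℕ} (r : ℝ) (A B : Set (Euc d)) (hA : MeasurableSet A)
    (hB : MeasurableSet B) :
    ∫⁻ x in A, volume (B \ ball x r) = ∫⁻ y in B, volume (A \ ball y r) := by
  have hS : MeasurableSet {p : Euc d × Euc d | p.1 ∈ A ∧ p.2 ∈ B ∧ r ≤ dist p.2 p.1} := by
    refine (measurable_fst hA).inter ((measurable_snd hB).inter ?_)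
    exact measurableSet_le measurable_const (measurable_snd.dist measurable_fst)
  have h1 := Measure.prod_apply (μ := (volume : Measure (Euc d))) (ν := (volume : Measure (Euc d))) hS
  have h2 := Measure.prod_apply_symm (μ := (volume : Measure (Euc d)))
    (ν := (volume : Measure (Euc d))) hS
  rw [h1] at h2
  rw [← lintegral_indicator hA, ← lintegral_indicator hB]
  convert h2 using 1
  · congr 1
    ext x
    by_cases hx : x ∈ A
    · rw [indicator_of_mem hx]
      congr 1
      ext y
      simp [hx]
    · rw [indicator_of_notMem hx]
      simp [hx]
  · congr 1
    ext x
    by_cases hx : x ∈ B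
    · rw [indicator_of_mem hx]
      congr 1
      ext y
      simp [hx, dist_comm]
    · rw [indicator_of_notMem hx]
      simp [hx]

theorem aux_half {d : ℕ} (r : ℝ) (A B : Set (Euc d)) (hBf : volume B ≠ ⊤)
    (h : ∀ x : Euc d, 2 * volume (ball x r) ≤ volume B) (hA : MeasurableSet A) :
    volume B * volume A ≤ 2 * ∫⁻ x in A, volume (B \ ball x r) := by
  have key : ∀ x : Euc d, volume B ≤ 2 * volume (B \ ball x r) := by
    intro x
    have h1 : volume B ≤ volume (B \ ball x r) + volume (ball x r) := by
      refine (measure_mono ?_).trans (measure_union_le _ _)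
      rw [diff_union_self]; exact subset_union_left
    have h2 : volume B + volume B ≤ 2 * volume (B \ ball x r) + volume B := by
      calc volume B + volume B = 2 * volume B := (two_mul _).symm
        _ ≤ 2 * (volume (B \ ball x r) + volume (ball x r)) := by gcongr
        _ = 2 * volume (B \ ball x r) + 2 * volume (ball x r) := mul_add _ _ _
        _ ≤ _ := by gcongr; exact h x
    exact (ENNReal.add_le_add_iff_right hBf).1 h2
  calc volume B * volume A = ∫⁻ x in A, volume B := by simp
    _ ≤ ∫⁻ x in A, 2 * volume (B \ ball x r) := lintegral_mono key
    _ = _ := lintegral_const_mul' _ _ (by simp)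

theorem aux_pt {d : ℕ} (C D E : Set (Euc d)) (hDC : D ⊆ C) (hD : MeasurableSet D)
    (hE : MeasurableSet E)
    (hC : volume C ≠ ⊤) (hD0 : volume D ≠ 0) (x : Euc d) :
    (x ∈ E → volume (D \ E) / volume C ≤ ENNReal.ofReal
      |E.indicator (fun _ => (1 : ℝ)) x -
          (volume D).toReal⁻¹ * ∫ y in D, E.indicator (fun _ => (1 : ℝ)) y|) ∧
    (x ∉ E → volume (D ∩ E) / volume C ≤ ENNReal.ofReal
      |E.indicator (fun _ => (1 : ℝ)) x -
          (volume D).toReal⁻¹ * ∫ y in D, E.indicator (fun _ => (1 : ℝ)) y|) := by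
  have hDf : volume D ≠ ⊤ := ne_top_of_le_ne_top hC (measure_mono hDC)
  have hD1 : volume (D \ E) ≠ ⊤ := ne_top_of_le_ne_top hDf (measure_mono diff_subset)
  have hD2 : volume (D ∩ E) ≠ ⊤ := ne_top_of_le_ne_top hDf (measure_mono inter_subset_left)
  have hI : ∫ y in D, E.indicator (fun _ => (1 : ℝ)) y = (volume (D ∩ E)).toReal := by
    rw [setIntegral_indicator hE]
    simp [Measure.real]
  have hpos : 0 < (volume D).toReal := ENNReal.toReal_pos hD0 hDf
  have hsum : (volume (D ∩ E)).toReal + (volume (D \ E)).toReal = (volume D).toReal := by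
    rw [← ENNReal.toReal_add hD2 hD1, measure_inter_add_diff D hE]
  have gen : ∀ a : ℝ≥0∞, a ≠ ⊤ → a / volume C ≤ ENNReal.ofReal (a.toReal / (volume D).toReal) := by
    intro a ha
    rw [ENNReal.ofReal_div_of_pos hpos, ENNReal.ofReal_toReal ha, ENNReal.ofReal_toReal hDf]
    exact ENNReal.div_le_div_left (measure_mono hDC) _
  rw [hI]
  constructor
  · intro hx
    rw [indicator_of_mem hx]
    refine (gen _ hD1).trans (ENNReal.ofReal_le_ofReal ((le_of_eq ?_).trans (le_abs_self _)))
    field_simp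
    linarith
  · intro hx
    rw [indicator_of_notMem hx]
    refine (gen _ hD2).trans (ENNReal.ofReal_le_ofReal ((le_of_eq ?_).trans (neg_le_abs _)))
    field_simp
    ring

/-- A lower bound, in terms of the nonlocal mean oscillation of `χ_E`,
for the product of the measures of `(lQ+ξ)∖E` and `(lQ+ξ)∩E`. -/
theorem stmt6 (d : ℕ) (hd : 2 ≤ d)
    (r l : ℝ) (hr : 0 < r) (hrl : r < l) (hvol : omegaB d * r ^ d < l ^ d / 4)
    (ξ : Euc d) (E : Set (Euc d)) (hEmeas : MeasurableSet E) (hEfin : volume E < ⊤) :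
    volume (cube d l ξ \ E) * volume (cube d l ξ ∩ E) / ENNReal.ofReal (l ^ d) ≤
      ∫⁻ x in cube d l ξ, ENNReal.ofReal
        |E.indicator (fun _ => (1 : ℝ)) x -
          (volume (cube d l ξ \ ball x r)).toReal⁻¹ *
            ∫ y in cube d l ξ \ ball x r, E.indicator (fun _ => (1 : ℝ)) y| := by
  have hl : 0 < l := hr.trans hrl
  have hCm := aux_cube_meas d l ξ
  have hCv := aux_cube_vol d l hl ξ
  have hb : ∀ x : Euc d, 4 * volume (ball x r) < volume (cube d l ξ) := by
    intro x
    rw [aux_ball_vol d r hr, hCv, show (4 : ℝ≥0∞) = ENNReal.ofReal 4 by simp,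
      ← ENNReal.ofReal_mul (by norm_num)]
    exact (ENNReal.ofReal_lt_ofReal_iff (by positivity)).2 (by linarith)
  rw [← hCv]
  have hCf : volume (cube d l ξ) ≠ ⊤ := by rw [hCv]; exact ENNReal.ofReal_ne_top
  generalize cube d l ξ = C at *
  have hAf : volume (C ∩ E) ≠ ⊤ := ne_top_of_le_ne_top hCf (measure_mono inter_subset_left)
  have hBf : volume (C \ E) ≠ ⊤ := ne_top_of_le_ne_top hCf (measure_mono diff_subset)
  have hAm := hCm.inter hEmeas
  have hBm := hCm.diff hEmeas
  have hsum := measure_inter_add_diff (μ := volume) C hEmeas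
  have hswap := aux_swap r (C ∩ E) (C \ E) hAm hBm
  have hD0 : ∀ x : Euc d, volume (C \ ball x r) ≠ 0 := by
    intro x h0
    have h1 : volume C ≤ volume (C \ ball x r) + volume (ball x r) := by
      refine (measure_mono ?_).trans (measure_union_le _ _)
      rw [diff_union_self]; exact subset_union_left
    rw [h0, zero_add] at h1
    have h2 : volume (ball x r) ≤ 4 * volume (ball x r) :=
      le_mul_of_one_le_left (by simp) (by norm_num)
    exact absurd (hb x) (not_lt.2 (h1.trans h2))
  have main : volume (C \ E) * volume (C ∩ E) ≤ 2 * ∫⁻ x in C ∩ E, volume ((C \ E) \ ball x r) := by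
    have dbl : ∀ a b : ℝ≥0∞, a + b = volume C → a ≤ b → ∀ x : Euc d,
        2 * volume (ball x r) ≤ b := by
      intro a b hab hle x
      have h1 : 2 * (2 * volume (ball x r)) ≤ 2 * b := by
        rw [← mul_assoc, two_mul b]
        norm_num
        calc _ ≤ volume C := (hb x).le
          _ = a + b := hab.symm
          _ ≤ b + b := by gcongr
      exact (ENNReal.mul_le_mul_iff_right (by simp) (by simp)).1 h1
    rcases le_total (volume (C ∩ E)) (volume (C \ E)) with h | h
    · exact aux_half r _ _ hBf (dbl _ _ hsum h) hAm
    · rw [hswap, mul_comm]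
      exact aux_half r _ _ hAf (dbl _ _ (by rw [add_comm]; exact hsum) h) hBm
  have hset1 : ∀ x : Euc d, (C \ E) \ ball x r = (C \ ball x r) \ E := fun x => diff_diff_comm
  have hset2 : ∀ x : Euc d, (C ∩ E) \ ball x r = (C \ ball x r) ∩ E := fun x => by
    ext y; simp only [mem_diff, mem_inter_iff]; tauto
  rw [← lintegral_inter_add_diff _ C hEmeas]
  calc volume (C \ E) * volume (C ∩ E) / volume C
      ≤ (2 * ∫⁻ x in C ∩ E, volume ((C \ E) \ ball x r)) / volume C := by gcongr
    _ = (∫⁻ x in C ∩ E, volume ((C \ E) \ ball x r) / volume C) +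
        ∫⁻ x in C \ E, volume ((C ∩ E) \ ball x r) / volume C := by
        have hC0 : (volume C)⁻¹ ≠ ⊤ := by
          rw [ENNReal.inv_ne_top]
          exact (lt_of_le_of_lt zero_le (hb 0)).ne'
        simp only [div_eq_mul_inv]
        rw [lintegral_mul_const' _ _ hC0, lintegral_mul_const' _ _ hC0, ← hswap, ← two_mul,
          mul_assoc]
    _ ≤ _ := by
        refine add_le_add (setLIntegral_mono' hAm fun x hx => ?_)
          (setLIntegral_mono' hBm fun x hx => ?_)
        · rw [hset1]
          exact (aux_pt C (C \ ball x r) E diff_subset (hCm.diff measurableSet_ball) hEmeas hCf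
            (hD0 x) x).1 hx.2
        · rw [hset2]
          exact (aux_pt C (C \ ball x r) E diff_subset (hCm.diff measurableSet_ball) hEmeas hCf
            (hD0 x) x).2 hx.2

end
end
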